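/- arXiv:2510.21888 — 3 statements merged into one kernel-verified Lean document; each statement's English description precedes it below -/
import Mathlib

section
/- Let C be a 3-CNF formula over n ≥ 1 variables with m ≥ 1 clauses, and set d = C(2n,1) + C(2n,2) + C(2n,3) − 2n² + n + 1 (where C(·,·) denotes binomial coefficients). Then for every stage h ∈ {1,…,n} there exists a feature map φ_h : {0,1}^{h−1} × {0,1} → ℝ^d, not depending on any suffix, such that for every suffix w ∈ {0,1}^{n−h} there exists a weight vector θ ∈ ℝ^d, not depending on (p, a), satisfying: for every prefix p ∈ {0,1}^{h−1} and every action a ∈ {0,1}, frac_C(p·a·w) = ⟨φ_h(p,a), θ⟩. -/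
open Finset BigOperators

/-- A clause over `n` variables: a finite set of literals `(i, s)`. -/
abbrev Clause (n : ℕ) := Finset (Fin n × Bool)

/-- A valid clause: nonempty, at most 3 literals, no complementary pair. -/
def validClause {n : ℕ} (c : Clause n) : Prop :=
  c.Nonempty ∧ c.card ≤ 3 ∧ ∀ i : Fin n, ¬((i, true) ∈ c ∧ (i, false) ∈ c)

/-- The clause `c` is satisfied by the assignment `x`. -/
def clauseSat {n : ℕ} (x : Fin n → Bool) (c : Clause n) : Prop :=
  ∃ l ∈ c, x l.1 = l.2

instance {n : ℕ} (x : Fin n → Bool) (c : Clause n) : Decidable (clauseSat x c) := by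
  unfold clauseSat; infer_instance

/-- Number of clauses of `C` (with multiplicity) satisfied by `x`. -/
def satC {n : ℕ} (C : List (Clause n)) (x : Fin n → Bool) : ℕ :=
  C.countP (fun c => decide (clauseSat x c))

/-- Fraction of clauses of `C` satisfied by `x`. -/
noncomputable def fracC {n : ℕ} (C : List (Clause n)) (x : Fin n → Bool) : ℝ :=
  (satC C x : ℝ) / (C.length : ℝ)

/-- Feature dimension `d = C(2n,1) + C(2n,2) + C(2n,3) − 2n² + n + 1`. -/
def dDim (n : ℕ) : ℕ :=
  (2 * n).choose 1 + (2 * n).choose 2 + (2 * n).choose 3 - 2 * n ^ 2 + n + 1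

/-- The assignment `p·a·w`: value `p i` below stage `h`, `a` at stage `h`,
and `w` above stage `h` (stage `h : Fin n` is 0-based, so it is the
`(h+1)`-st variable; the prefix has `h.val` coordinates and the suffix
`n - h.val - 1` coordinates). -/
def splice {n : ℕ} (h : Fin n) (p : Fin h.val → Bool) (a : Bool)
    (w : Fin (n - h.val - 1) → Bool) : Fin n → Bool :=
  fun i =>
    if hi : i.val < h.val then p ⟨i.val, hi⟩
    else if he : i.val = h.val then a
    else w ⟨i.val - h.val - 1, by have := i.2; omega⟩

/-- The multilinear monomial `∏ i ∈ S, y i` as a real function on the Boolean cube. -/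
def cubeMonomial {n : ℕ} (S : Finset (Fin n)) (y : Fin n → Bool) : ℝ :=
  ∏ i ∈ S, if y i then 1 else 0

/-- The functions on the Boolean cube of degree at most `k`. -/
def cubePoly (n k : ℕ) : Submodule ℝ ((Fin n → Bool) → ℝ) :=
  Submodule.span ℝ (Set.range fun S : {S : Finset (Fin n) // S.card ≤ k} => cubeMonomial S.1)

lemma cubeMonomial_mem {n k : ℕ} {S : Finset (Fin n)} (hS : S.card ≤ k) :
    cubeMonomial S ∈ cubePoly n k :=
  Submodule.subset_span ⟨⟨S, hS⟩, rfl⟩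

lemma cubePoly_mono (n : ℕ) {k l : ℕ} (hkl : k ≤ l) : cubePoly n k ≤ cubePoly n l := by
  refine Submodule.span_le.2 ?_
  rintro _ ⟨S, rfl⟩
  exact cubeMonomial_mem (S.2.trans hkl)

lemma one_mem_cubePoly (n k : ℕ) : (1 : (Fin n → Bool) → ℝ) ∈ cubePoly n k := by
  have : (1 : (Fin n → Bool) → ℝ) = cubeMonomial ∅ := by
    ext y; simp [cubeMonomial]
  rw [this]
  exact cubeMonomial_mem (by simp)

lemma coord_mul_cubeMonomial {n : ℕ} (j : Fin n) (S : Finset (Fin n)) (y : Fin n → Bool) :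
    (if y j then 1 else 0) * cubeMonomial S y = cubeMonomial (insert j S) y := by
  by_cases hj : j ∈ S
  · rw [Finset.insert_eq_of_mem hj]
    by_cases hy : y j = true
    · simp [hy]
    · simp only [hy]
      rw [cubeMonomial, Finset.prod_eq_zero hj (by simp [hy])]
      simp
  · simp [cubeMonomial, Finset.prod_insert hj]

lemma coord_mul_mem_cubePoly {n k : ℕ} (j : Fin n) {f : (Fin n → Bool) → ℝ}
    (hf : f ∈ cubePoly n k) :
    (fun y : Fin n → Bool => (if y j then 1 else 0) * f y) ∈ cubePoly n (k + 1) := by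
  induction hf using Submodule.span_induction with
  | mem f hf =>
    obtain ⟨S, rfl⟩ := hf
    simp only [coord_mul_cubeMonomial]
    exact cubeMonomial_mem ((Finset.card_insert_le _ _).trans (Nat.succ_le_succ S.2))
  | zero =>
    convert (cubePoly n (k + 1)).zero_mem using 1
    ext y; simp
  | add f g _ _ hf hg =>
    convert (cubePoly n (k + 1)).add_mem hf hg using 1
    ext y; simp only [Pi.add_apply, mul_add]
  | smul r f _ hf =>
    convert (cubePoly n (k + 1)).smul_mem r hf using 1
    ext y; simp only [Pi.smul_apply, smul_eq_mul]; ring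

lemma prod_affine_mem_cubePoly {n : ℕ} (c : Clause n) (α β : Fin n × Bool → ℝ) :
    (fun y : Fin n → Bool => ∏ l ∈ c, (α l + β l * if y l.1 then 1 else 0))
      ∈ cubePoly n c.card := by
  induction c using Finset.induction_on with
  | empty => exact one_mem_cubePoly n 0
  | insert l c hl ih =>
    rw [Finset.card_insert_of_notMem hl]
    convert (cubePoly n (c.card + 1)).add_mem
      ((cubePoly n _).smul_mem (α l) (cubePoly_mono n (Nat.le_succ _) ih))
      ((cubePoly n _).smul_mem (β l) (coord_mul_mem_cubePoly l.1 ih)) using 1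
    ext y
    simp only [Finset.prod_insert hl, Pi.add_apply, Pi.smul_apply, smul_eq_mul]
    ring

/-- Keep the coordinates of `y` up to position `h`, and take those of `z` after it. -/
def overwriteAfter {n : ℕ} (h : Fin n) (z y : Fin n → Bool) : Fin n → Bool :=
  fun i => if i ≤ h then y i else z i

lemma overwriteAfter_splice {n : ℕ} (h : Fin n) (p q : Fin h.val → Bool) (a b : Bool)
    (v w : Fin (n - h.val - 1) → Bool) :
    overwriteAfter h (splice h q b w) (splice h p a v) = splice h p a w := by
  ext i
  simp only [overwriteAfter, splice, Fin.le_def]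
  split_ifs <;> first | rfl | omega

lemma clauseSat_indicator {n : ℕ} (x : Fin n → Bool) (c : Clause n) :
    (if clauseSat x c then 1 else 0 : ℝ) = 1 - ∏ l ∈ c, if x l.1 = l.2 then 0 else 1 := by
  by_cases hx : clauseSat x c
  · obtain ⟨l, hl, hxl⟩ := id hx
    rw [if_pos hx, Finset.prod_eq_zero hl (by simp [hxl])]
    simp
  · rw [if_neg hx, Finset.prod_eq_one, sub_self]
    intro l hl
    exact if_neg fun hxl => hx ⟨l, hl, hxl⟩

lemma clauseSat_overwriteAfter_mem {n : ℕ} (h : Fin n) (z : Fin n → Bool) (c : Clause n) :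
    (fun y => if clauseSat (overwriteAfter h z y) c then 1 else 0 : (Fin n → Bool) → ℝ)
      ∈ cubePoly n c.card := by
  have key := prod_affine_mem_cubePoly c
    (fun l => if l.1 ≤ h then (if l.2 then 1 else 0) else (if z l.1 = l.2 then 0 else 1))
    (fun l => if l.1 ≤ h then (if l.2 then -1 else 1) else 0)
  convert (cubePoly n c.card).sub_mem (one_mem_cubePoly n _) key using 1
  ext y
  rw [clauseSat_indicator]
  simp only [Pi.sub_apply, Pi.one_apply]
  congr 1
  refine Finset.prod_congr rfl fun l _ => ?_
  by_cases hl : l.1 ≤ h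
  · cases hy : y l.1 <;> cases hs : l.2 <;> simp [overwriteAfter, hl, hy]
  · simp [overwriteAfter, hl]

lemma satC_cons {n : ℕ} (c : Clause n) (C : List (Clause n)) (x : Fin n → Bool) :
    (satC (c :: C) x : ℝ) = satC C x + if clauseSat x c then 1 else 0 := by
  simp only [satC, List.countP_cons, decide_eq_true_eq]
  push_cast
  rfl

lemma satC_overwriteAfter_mem {n k : ℕ} (h : Fin n) (z : Fin n → Bool) (C : List (Clause n))
    (hC : ∀ c ∈ C, c.card ≤ k) :
    (fun y => (satC C (overwriteAfter h z y) : ℝ)) ∈ cubePoly n k := by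
  induction C with
  | nil =>
    convert (cubePoly n k).zero_mem using 1
    ext y; simp [satC]
  | cons c C ih =>
    simp only [satC_cons]
    exact (cubePoly n k).add_mem (ih fun c hc => hC c (List.mem_cons_of_mem _ hc))
      (cubePoly_mono n (hC c List.mem_cons_self) (clauseSat_overwriteAfter_mem h z c))

lemma card_finset_card_le (n k : ℕ) :
    Fintype.card {S : Finset (Fin n) // S.card ≤ k} ≤ ∑ j ∈ Finset.range (k + 1), n.choose j := by
  rw [Fintype.card_subtype]
  calc _ ≤ ((Finset.range (k + 1)).biUnion
        fun j => Finset.powersetCard j (Finset.univ : Finset (Fin n))).card := by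
        refine Finset.card_le_card fun S hS => ?_
        simp only [Finset.mem_filter] at hS
        simp [Finset.mem_powersetCard, hS.2]
    _ ≤ _ := Finset.card_biUnion_le.trans (by simp)

lemma sum_choose_le_dDim {n : ℕ} (hn : 1 ≤ n) :
    ∑ j ∈ Finset.range 4, n.choose j ≤ dDim n := by
  have h_two : (2 * n).choose 2 + n = 2 * n ^ 2 := by
    obtain ⟨k, rfl⟩ := Nat.exists_eq_add_of_le' hn
    rw [Nat.choose_two_right, mul_assoc, Nat.mul_div_cancel_left _ two_pos,
      show 2 * (k + 1) - 1 = 2 * k + 1 by omega]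
    ring
  have h_three : n.choose 2 + n.choose 3 ≤ (2 * n).choose 3 :=
    (Nat.choose_succ_succ n 2).symm.trans_le (Nat.choose_le_choose 3 (by omega))
  simp only [Finset.sum_range_succ, Finset.sum_range_zero, dDim, Nat.choose_zero_right,
    Nat.choose_one_right]
  omega

/-- For a 3-CNF formula `C` over `n ≥ 1` variables with `m ≥ 1`
clauses and `d = C(2n,1) + C(2n,2) + C(2n,3) − 2n² + n + 1`, for every stage `h`
there is a feature map `φ_h` (independent of any suffix) such that for every
suffix `w` there is a weight vector `θ` (independent of `(p, a)`) with
`frac_C(p·a·w) = ⟨φ_h(p,a), θ⟩` for all prefixes `p` and actions `a`. -/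
theorem stmt_0 (n : ℕ) (hn : 1 ≤ n) (C : List (Clause n)) (hm : 1 ≤ C.length)
    (hC : ∀ c ∈ C, validClause c) (h : Fin n) :
    ∃ φ : (Fin h.val → Bool) → Bool → (Fin (dDim n) → ℝ),
      ∀ w : Fin (n - h.val - 1) → Bool,
        ∃ θ : Fin (dDim n) → ℝ,
          ∀ (p : Fin h.val → Bool) (a : Bool),
            fracC C (splice h p a w) = ∑ i, φ p a i * θ i := by
  have h_card : Fintype.card {S : Finset (Fin n) // S.card ≤ 3} ≤ Fintype.card (Fin (dDim n)) := by
    rw [Fintype.card_fin]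
    exact (card_finset_card_le n 3).trans (sum_choose_le_dDim hn)
  obtain ⟨e⟩ := Function.Embedding.nonempty_of_card_le h_card
  have : Nonempty {S : Finset (Fin n) // S.card ≤ 3} := ⟨⟨∅, by simp⟩⟩
  have h_surj := Function.invFun_surjective e.injective
  refine ⟨fun p a i => cubeMonomial (Function.invFun e i).1 (splice h p a fun _ => false),
    fun w => ?_⟩
  have h_mem := (cubePoly n 3).smul_mem (C.length : ℝ)⁻¹
    (satC_overwriteAfter_mem h (splice h (fun _ => false) false w) C fun c hc => (hC c hc).2.1)
  rw [cubePoly, ← h_surj.range_comp, Submodule.mem_span_range_iff_exists_fun] at h_mem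
  obtain ⟨θ, hθ⟩ := h_mem
  refine ⟨θ, fun p a => ?_⟩
  have h_eval := congrFun hθ (splice h p a fun _ => false)
  simp only [Finset.sum_apply, Pi.smul_apply, smul_eq_mul, overwriteAfter_splice,
    Function.comp_apply] at h_eval
  rw [fracC, div_eq_inv_mul, ← h_eval]
  exact Finset.sum_congr rfl fun i _ => mul_comm _ _
end

section
/- Let C be a 3-CNF formula over n ≥ 1 variables with m ≥ 1 clauses, and set d = C(2n,1) + C(2n,2) + C(2n,3) − 2n² + n + 1. Then for every stage h ∈ {1,…,n} there exists a feature map φ_h : {0,1}^{h−1} × {0,1} → ℝ^d, not depending on any suffix distribution, such that for every probability vector q ∈ [0,1]^{n−h} there exists a weight vector θ ∈ ℝ^d, not depending on (p, a), satisfying: for every prefix p ∈ {0,1}^{h−1} and every action a ∈ {0,1}, E_W[frac_C(p·a·W)] = ⟨φ_h(p,a), θ⟩, where W = (W_{h+1},…,W_n) has independent {0,1}-valued coordinates with P(W_j = 1) = q_j. -/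
open Finset BigOperators

/-- The span of the products of at most `k` of the functions `y i`. -/
def lowDegree {ι X : Type*} (y : ι → X → ℝ) (k : ℕ) : Submodule ℝ (X → ℝ) :=
  Submodule.span ℝ (Set.range fun S : {S : Finset ι // S.card ≤ k} => ∏ i ∈ S.1, y i)

lemma prod_mem_lowDegree {ι X : Type*} (y : ι → X → ℝ) {k : ℕ} (S : Finset ι)
    (hS : S.card ≤ k) : ∏ i ∈ S, y i ∈ lowDegree y k :=
  Submodule.subset_span ⟨⟨S, hS⟩, rfl⟩

lemma lowDegree_mono {ι X : Type*} (y : ι → X → ℝ) {k l : ℕ} (h : k ≤ l) :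
    lowDegree y k ≤ lowDegree y l := by
  refine Submodule.span_le.2 ?_
  rintro _ ⟨⟨S, hS⟩, rfl⟩
  exact prod_mem_lowDegree y S (hS.trans h)

lemma one_mem_lowDegree {ι X : Type*} (y : ι → X → ℝ) (k : ℕ) : 1 ∈ lowDegree y k := by
  simpa using prod_mem_lowDegree y (k := k) ∅ (by simp)

/-- Multiplying by one idempotent generator raises the degree by at most one. -/
lemma mul_mem_lowDegree {ι X : Type*} [DecidableEq ι] (y : ι → X → ℝ)
    (hy : ∀ i, y i * y i = y i) {k : ℕ} (i : ι) {f : X → ℝ} (hf : f ∈ lowDegree y k) :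
    y i * f ∈ lowDegree y (k + 1) := by
  induction hf using Submodule.span_induction with
  | mem f hf =>
    obtain ⟨⟨S, hS⟩, rfl⟩ := hf
    have key : y i * ∏ j ∈ S, y j = ∏ j ∈ insert i S, y j := by
      by_cases hi : i ∈ S
      · rw [insert_eq_of_mem hi, ← mul_prod_erase S y hi, ← mul_assoc, hy]
      · rw [prod_insert hi]
    simp only [key]
    exact prod_mem_lowDegree y _ ((card_insert_le i S).trans (by omega))
  | zero => simp
  | add f g _ _ hf hg => rw [mul_add]; exact add_mem hf hg
  | smul c f _ hf => rw [mul_smul_comm]; exact Submodule.smul_mem _ c hf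

/-- A product of functions, each affine in a single generator, has degree at most the number
of factors. -/
lemma prod_affine_mem_lowDegree {ι κ X : Type*} [DecidableEq ι] (y : ι → X → ℝ)
    (hy : ∀ i, y i * y i = y i) (c : Finset κ) (v : κ → ι) (g : κ → X → ℝ)
    (hg : ∀ l ∈ c, ∃ α β : ℝ, g l = α • (1 : X → ℝ) + β • y (v l)) :
    ∏ l ∈ c, g l ∈ lowDegree y c.card := by
  classical
  induction c using Finset.induction_on with
  | empty => simpa using one_mem_lowDegree y 0
  | insert l c hl ih =>
    have ih' := ih fun l' h' => hg l' (mem_insert_of_mem h')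
    obtain ⟨α, β, h⟩ := hg l (mem_insert_self l c)
    rw [prod_insert hl, card_insert_of_notMem hl, h, add_mul, smul_mul_assoc, smul_mul_assoc,
      one_mul]
    exact add_mem (Submodule.smul_mem _ α (lowDegree_mono y (Nat.le_succ _) ih'))
      (Submodule.smul_mem _ β (mul_mem_lowDegree y hy _ ih'))

/-- The fraction of satisfied clauses has degree at most 3, along any family `x` of assignments
whose coordinate indicators are affine in the generators. -/
lemma fracC_mem_lowDegree {n : ℕ} {X : Type*} (y : Fin n → X → ℝ)
    (hy : ∀ i, y i * y i = y i) (x : X → Fin n → Bool)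
    (hx : ∀ i s, ∃ α β : ℝ, (fun t => if x t i = s then (0 : ℝ) else 1)
      = α • (1 : X → ℝ) + β • y i)
    (C : List (Clause n)) (hC : ∀ c ∈ C, c.card ≤ 3) :
    (fun t => fracC C (x t)) ∈ lowDegree y 3 := by
  have hsat : (fun t => (satC C (x t) : ℝ)) ∈ lowDegree y 3 := by
    induction C with
    | nil =>
      convert zero_mem (lowDegree y 3) using 1
      funext t
      simp [satC]
    | cons c C ih =>
      have hc : (fun t => if clauseSat (x t) c then (1 : ℝ) else 0) ∈ lowDegree y 3 := by
        have h := sub_mem (one_mem_lowDegree y 3)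
          (lowDegree_mono y (hC c (by simp)) (prod_affine_mem_lowDegree y hy c Prod.fst
            (fun l t => if x t l.1 = l.2 then (0 : ℝ) else 1) fun l _ => hx l.1 l.2))
        convert h using 1
        funext t
        simp only [Pi.sub_apply, Pi.one_apply, Finset.prod_apply]
        split_ifs with hs
        · obtain ⟨l, hl, hls⟩ := hs
          rw [prod_eq_zero hl (by simp [hls]), sub_zero]
        · rw [prod_eq_one fun l hl => if_neg fun hls => hs ⟨l, hl, hls⟩, sub_self]
      convert add_mem (ih fun c' h' => hC c' (by simp [h'])) hc using 1
      funext t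
      simp [satC, List.countP_cons]
  convert Submodule.smul_mem _ ((C.length : ℝ)⁻¹) hsat using 1
  funext t
  simp [fracC, div_eq_inv_mul]

lemma card_finset_card_le_three_le_dDim {n : ℕ} (hn : 1 ≤ n) :
    Fintype.card {S : Finset (Fin n) // S.card ≤ 3} ≤ dDim n := by
  have h1 : Fintype.card {S : Finset (Fin n) // S.card ≤ 3} ≤ ∑ k ∈ range 4, n.choose k := by
    rw [Fintype.card_subtype]
    calc _ ≤ ((range 4).biUnion fun k => powersetCard k (univ : Finset (Fin n))).card := by
          refine card_le_card fun S hS => ?_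
          simp only [mem_filter, mem_univ, true_and] at hS
          simpa [mem_powersetCard] using Nat.lt_succ_of_le hS
      _ ≤ ∑ k ∈ range 4, (powersetCard k (univ : Finset (Fin n))).card := card_biUnion_le
      _ = _ := by simp [card_powersetCard]
  have h2 : n.choose 2 + n.choose 3 ≤ (2 * n).choose 3 :=
    (Nat.choose_succ_succ' n 2).symm.le.trans (Nat.choose_le_choose 3 (by omega))
  have h3 : (2 * n).choose 2 + n = 2 * n ^ 2 := by
    obtain ⟨k, rfl⟩ := Nat.exists_eq_add_of_le' hn
    have h : 2 * (k + 1) * (2 * (k + 1) - 1) = 2 * ((k + 1) * (2 * k + 1)) := by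
      rw [show 2 * (k + 1) - 1 = 2 * k + 1 by omega]; ring
    rw [Nat.choose_two_right, h, Nat.mul_div_cancel_left _ two_pos]
    ring
  simp only [sum_range_succ, range_zero, sum_empty, Nat.choose_zero_right,
    Nat.choose_one_right] at h1
  simp only [dDim, Nat.choose_one_right]
  omega

/-- Linear realizability of the expected satisfaction fraction
under an arbitrary product-Bernoulli suffix distribution `q ∈ [0,1]^{n−h}`:
the feature map `φ_h` does not depend on the suffix distribution, and the
weight vector `θ` does not depend on `(p, a)`. -/
theorem stmt_1 (n : ℕ) (hn : 1 ≤ n) (C : List (Clause n)) (hm : 1 ≤ C.length)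
    (hC : ∀ c ∈ C, validClause c) (h : Fin n) :
    ∃ φ : (Fin h.val → Bool) → Bool → (Fin (dDim n) → ℝ),
      ∀ q : Fin (n - h.val - 1) → ℝ, (∀ j, 0 ≤ q j ∧ q j ≤ 1) →
        ∃ θ : Fin (dDim n) → ℝ,
          ∀ (p : Fin h.val → Bool) (a : Bool),
            (∑ w : Fin (n - h.val - 1) → Bool,
                (∏ j, if w j then q j else 1 - q j) * fracC C (splice h p a w))
              = ∑ i, φ p a i * θ i := by
  classical
  let y : Fin n → (Fin h.val → Bool) × Bool → ℝ :=
    fun i t => if splice h t.1 t.2 (fun _ => false) i then 1 else 0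
  have hy : ∀ i, y i * y i = y i := fun i => by
    funext t
    simp [y]
  have hx : ∀ w i s, ∃ α β : ℝ,
      (fun t : (Fin h.val → Bool) × Bool => if splice h t.1 t.2 w i = s then (0 : ℝ) else 1)
        = α • 1 + β • y i := by
    intro w i s
    by_cases hi : i.val ≤ h.val
    · have heq : ∀ p a, splice h p a w i = splice h p a (fun _ => false) i := by
        intro p a
        unfold splice
        split_ifs <;> first | rfl | omega
      refine ⟨if s then 1 else 0, if s then -1 else 1, ?_⟩
      funext t
      simp only [heq, y, Pi.add_apply, Pi.smul_apply, Pi.one_apply, smul_eq_mul]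
      cases s <;> cases splice h t.1 t.2 (fun _ => false) i <;> simp
    · refine ⟨if w ⟨i.val - h.val - 1, by omega⟩ = s then (0 : ℝ) else 1, 0, ?_⟩
      funext t
      simp only [splice, dif_neg (show ¬ i.val < h.val by omega),
        dif_neg (show ¬ i.val = h.val by omega), Pi.add_apply, Pi.smul_apply, Pi.one_apply,
        smul_eq_mul, mul_one, zero_mul, add_zero]
  obtain ⟨e⟩ : Nonempty ({S : Finset (Fin n) // S.card ≤ 3} ↪ Fin (dDim n)) :=
    Function.Embedding.nonempty_of_card_le (by
      simpa using card_finset_card_le_three_le_dDim hn)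
  refine ⟨fun p a => Function.extend e (fun S => (∏ i ∈ S.1, y i) (p, a)) 0, fun q _ => ?_⟩
  have hmem : ∑ w : Fin (n - h.val - 1) → Bool, (∏ j, if w j then q j else 1 - q j) •
      (fun t : (Fin h.val → Bool) × Bool => fracC C (splice h t.1 t.2 w)) ∈ lowDegree y 3 :=
    Submodule.sum_mem _ fun w _ => Submodule.smul_mem _ _
      (fracC_mem_lowDegree y hy _ (hx w) C fun c hc => (hC c hc).2.1)
  obtain ⟨θ, hθ⟩ := (Submodule.mem_span_range_iff_exists_fun ℝ).1 hmem
  refine ⟨Function.extend e θ 0, fun p a => ?_⟩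
  have hpa := congrFun hθ (p, a)
  simp only [Finset.sum_apply, Pi.smul_apply, smul_eq_mul] at hpa
  rw [← hpa]
  refine Fintype.sum_of_injective e e.injective _ _ (fun i hi => ?_) fun S => ?_
  · rw [Function.extend_apply' _ _ _ fun ⟨S, hS⟩ => hi ⟨S, hS⟩, Pi.zero_apply, mul_zero]
  · simp only [e.injective.extend_apply, mul_comm]
end

section
/- Let C be a 3-CNF formula over n ≥ 1 variables with m ≥ 1 clauses in which every variable occurs in at most b ≥ 1 clauses, and let v* = max_{x ∈ {0,1}^n} frac_C(x). Let X = (X_1,…,X_n) be independent {0,1}-valued random variables with P(X_j = 1) = q_j for some q ∈ [0,1]^n, and set R = frac_C(X). Let δ ∈ (0,1), p₀ ∈ (0,1), and ε > 0 satisfy E[R] ≥ v* − ε and ε ≤ v* + δ − (b/m)·√((n+1)·ln(1/p₀)/2) − 1. Then P(R ≥ 1 − δ) ≥ 1 − p₀. -/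
open Finset BigOperators

/-- The weight of the assignment `x` under the product-Bernoulli distribution
with success probabilities `q`. -/
noncomputable def wt {n : ℕ} (q : Fin n → ℝ) (x : Fin n → Bool) : ℝ :=
  ∏ j, if x j then q j else 1 - q j

/-- The expectation `E[frac_C(X)]` when `X` is product-Bernoulli with
parameters `q`. -/
noncomputable def expFrac {n : ℕ} (C : List (Clause n)) (q : Fin n → ℝ) : ℝ :=
  ∑ x : Fin n → Bool, wt q x * fracC C x

/-- Number of clauses of `C` (with multiplicity) in which variable `i` occurs. -/
def occCount {n : ℕ} (C : List (Clause n)) (i : Fin n) : ℕ :=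
  C.countP (fun c => decide (∃ s : Bool, (i, s) ∈ c))

open MeasureTheory ProbabilityTheory in
/-- Hoeffding's lemma for a two-point distribution. -/
lemma two_point_exp_le {p : ℝ} (hp0 : 0 ≤ p) (hp1 : p ≤ 1) {c : ℝ} (u v : ℝ)
    (huv : |u - v| ≤ c) :
    p * Real.exp u + (1 - p) * Real.exp v ≤
      Real.exp (p * u + (1 - p) * v + c ^ 2 / 8) := by
  let μ : Measure ℝ :=
    ENNReal.ofReal p • Measure.dirac u + ENNReal.ofReal (1 - p) • Measure.dirac v
  have hμ : IsProbabilityMeasure μ := ⟨by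
    simp only [μ, Measure.add_apply, Measure.smul_apply, measure_univ, smul_eq_mul, mul_one]
    rw [← ENNReal.ofReal_add hp0 (by linarith)]
    simp⟩
  have hint (f : ℝ → ℝ) : ∫ x, f x ∂μ = p * f u + (1 - p) * f v := by
    have hi (r w : ℝ) : Integrable f (ENNReal.ofReal r • Measure.dirac w) :=
      (integrable_dirac (by simp)).smul_measure ENNReal.ofReal_ne_top
    rw [integral_add_measure (hi _ _) (hi _ _), integral_smul_measure, integral_smul_measure,
      integral_dirac, integral_dirac, ENNReal.toReal_ofReal hp0,
      ENNReal.toReal_ofReal (by linarith), smul_eq_mul, smul_eq_mul]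
  have hmem : ∀ᵐ x ∂μ, id x ∈ Set.Icc (min u v) (max u v) := by
    simp only [μ, ae_add_measure_iff]
    constructor <;> refine Measure.ae_smul_measure ?_ _ <;> rw [ae_dirac_eq] <;> simp
  have h := (hasSubgaussianMGF_of_mem_Icc aemeasurable_id hmem).mgf_le 1
  rw [mgf, hint, hint] at h
  have hsq : (max u v - min u v) ^ 2 ≤ c ^ 2 := by
    rw [max_sub_min_eq_abs, abs_sub_comm]
    gcongr
  simp only [id, one_mul, one_pow, mul_one, NNReal.coe_pow, NNReal.coe_div, coe_nnnorm,
    Real.norm_eq_abs, NNReal.coe_ofNat, div_pow, sq_abs] at h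
  calc p * Real.exp u + (1 - p) * Real.exp v
      = Real.exp (p * u + (1 - p) * v) *
          (p * Real.exp (u - (p * u + (1 - p) * v)) +
            (1 - p) * Real.exp (v - (p * u + (1 - p) * v))) := by
        rw [Real.exp_sub, Real.exp_sub]; field_simp
    _ ≤ Real.exp (p * u + (1 - p) * v) *
          Real.exp ((max u v - min u v) ^ 2 / 2 ^ 2 / 2) := by gcongr
    _ ≤ _ := by
        rw [← Real.exp_add]
        exact Real.exp_le_exp.2 (by linarith)

lemma wt_nonneg {n : ℕ} {q : Fin n → ℝ} (hq : ∀ j, 0 ≤ q j ∧ q j ≤ 1) (x : Fin n → Bool) :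
    0 ≤ wt q x := by
  refine prod_nonneg fun j _ => ?_
  split_ifs
  · exact (hq j).1
  · linarith [(hq j).2]

/-- Summing over the first coordinate of a product-Bernoulli assignment. -/
lemma sum_wt_succ {n : ℕ} (q : Fin (n + 1) → ℝ) (f : (Fin (n + 1) → Bool) → ℝ) :
    ∑ x, wt q x * f x =
      ∑ x, wt (Fin.tail q) x *
        (q 0 * f (Fin.cons true x) + (1 - q 0) * f (Fin.cons false x)) := by
  rw [← (Fin.consEquiv fun _ => Bool).sum_comp, Fintype.sum_prod_type, Fintype.sum_bool,
    ← sum_add_distrib]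
  refine sum_congr rfl fun x _ => ?_
  simp only [Fin.consEquiv, Equiv.coe_fn_mk, wt, Fin.prod_univ_succ, Fin.cons_zero,
    Fin.cons_succ, Fin.tail, if_true, Bool.false_eq_true, if_false]
  ring

lemma sum_wt {n : ℕ} (q : Fin n → ℝ) : ∑ x, wt q x = 1 := by
  induction n with
  | zero => simp [wt]
  | succ n ih => simpa [ih] using sum_wt_succ q fun _ => 1

/-- The moment generating function bound behind McDiarmid's inequality. -/
lemma sum_wt_exp_le {n : ℕ} {q : Fin n → ℝ} (hq : ∀ j, 0 ≤ q j ∧ q j ≤ 1) {c : ℝ}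
    (f : (Fin n → Bool) → ℝ) (hf : ∀ x i v, |f (Function.update x i v) - f x| ≤ c) :
    ∑ x, wt q x * Real.exp (f x) ≤ Real.exp (∑ x, wt q x * f x + n * (c ^ 2 / 8)) := by
  induction n with
  | zero => simp [wt]
  | succ n ih =>
    rw [sum_wt_succ, sum_wt_succ]
    have hp0 := (hq 0).1
    have hp1 : 0 ≤ 1 - q 0 := sub_nonneg.2 (hq 0).2
    have hq' : ∀ j, 0 ≤ Fin.tail q j ∧ Fin.tail q j ≤ 1 := fun j => hq j.succ
    let g : (Fin n → Bool) → ℝ := fun x =>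
      q 0 * f (Fin.cons true x) + (1 - q 0) * f (Fin.cons false x)
    have hg : ∀ x i v, |g (Function.update x i v) - g x| ≤ c := fun x i v => by
      have ht := abs_le.1 (hf (Fin.cons true x) i.succ v)
      have hf := abs_le.1 (hf (Fin.cons false x) i.succ v)
      rw [← Fin.cons_update] at ht hf
      simp only [g]
      exact abs_le.2 ⟨by nlinarith, by nlinarith⟩
    calc _ ≤ ∑ x, wt (Fin.tail q) x * Real.exp (g x + c ^ 2 / 8) := by
          gcongr with x
          · exact wt_nonneg hq' x
          · refine two_point_exp_le (hq 0).1 (hq 0).2 _ _ ?_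
            simpa [Fin.update_cons_zero] using hf (Fin.cons false x) 0 true
      _ = (∑ x, wt (Fin.tail q) x * Real.exp (g x)) * Real.exp (c ^ 2 / 8) := by
          simp only [Real.exp_add, sum_mul, mul_assoc]
      _ ≤ Real.exp (∑ x, wt (Fin.tail q) x * g x + n * (c ^ 2 / 8)) * Real.exp (c ^ 2 / 8) := by
          gcongr
          exact ih hq' g hg
      _ = _ := by
          rw [← Real.exp_add]
          push_cast
          congr 1
          ring

lemma clauseSat_update_iff {n : ℕ} {c : Clause n} {i : Fin n} (hi : ¬∃ s : Bool, (i, s) ∈ c)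
    (x : Fin n → Bool) (v : Bool) : clauseSat (Function.update x i v) c ↔ clauseSat x c := by
  refine exists_congr fun l => and_congr_right fun hl => ?_
  rw [Function.update_of_ne]
  rintro rfl
  exact hi ⟨l.2, hl⟩

/-- Flipping variable `i` affects only the clauses in which it occurs. -/
lemma abs_satC_update_sub_le {n : ℕ} (C : List (Clause n)) (x : Fin n → Bool) (i : Fin n)
    (v : Bool) : |(satC C (Function.update x i v) : ℝ) - satC C x| ≤ occCount C i := by
  induction C with
  | nil => simp [satC, occCount]
  | cons c C ih =>
    simp only [satC, occCount, List.countP_cons, decide_eq_true_eq] at ih ⊢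
    rw [abs_le] at ih ⊢
    obtain ⟨ih₁, ih₂⟩ := ih
    by_cases hi : ∃ s : Bool, (i, s) ∈ c
    · rw [if_pos hi]
      push_cast
      constructor <;> split_ifs <;> linarith
    · rw [if_neg hi]
      simp only [clauseSat_update_iff hi]
      push_cast
      constructor <;> linarith

/-- One-sided Chernoff bound for the lower tail. -/
lemma sum_wt_lt_le {n : ℕ} {q : Fin n → ℝ} (hq : ∀ j, 0 ≤ q j ∧ q j ≤ 1) {c : ℝ}
    (f : (Fin n → Bool) → ℝ) (hf : ∀ x i v, |f (Function.update x i v) - f x| ≤ c)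
    (a : ℝ) {s : ℝ} (hs : 0 ≤ s) :
    ∑ x, (if a ≤ f x then 0 else wt q x) ≤
      Real.exp (s * (a - ∑ x, wt q x * f x) + n * ((s * c) ^ 2 / 8)) := by
  have h := sum_wt_exp_le hq (c := s * c) (fun x => s * (a - f x)) fun x i v => by
    rw [← mul_sub, abs_mul, abs_of_nonneg hs, sub_sub_sub_cancel_left, abs_sub_comm]
    exact mul_le_mul_of_nonneg_left (hf x i v) hs
  have hmean : ∑ x, wt q x * (s * (a - f x)) = s * (a - ∑ x, wt q x * f x) := by
    simp only [mul_sub, sum_sub_distrib, mul_sum, mul_left_comm _ s]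
    simp only [← mul_sum, ← sum_mul, sum_wt, one_mul]
  rw [hmean] at h
  refine le_trans (sum_le_sum fun x _ => ?_) h
  have hw := wt_nonneg hq x
  split_ifs with hx
  · positivity
  · exact le_mul_of_one_le_right hw
      (Real.one_le_exp (mul_nonneg hs (by linarith [not_le.1 hx])))

open scoped Classical in
/-- With `v* = max_x frac_C(x)`, if every variable occurs in at
most `b` clauses, `X` is product-Bernoulli with parameters `q`, `R = frac_C(X)`,
`E[R] ≥ v* − ε`, and `ε ≤ v* + δ − (b/m)·√((n+1)·ln(1/p₀)/2) − 1`, then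
`P(R ≥ 1 − δ) ≥ 1 − p₀`. -/
theorem stmt_6 (n : ℕ) (hn : 1 ≤ n) (C : List (Clause n)) (hm : 1 ≤ C.length)
    (hC : ∀ c ∈ C, validClause c) (b : ℕ) (hb : 1 ≤ b)
    (hocc : ∀ i : Fin n, occCount C i ≤ b)
    (q : Fin n → ℝ) (hq : ∀ j, 0 ≤ q j ∧ q j ≤ 1)
    (δ p₀ ε : ℝ) (hδ0 : 0 < δ) (hδ1 : δ < 1) (hp0 : 0 < p₀) (hp1 : p₀ < 1) (hε0 : 0 < ε)
    (hE : (⨆ x : Fin n → Bool, fracC C x) - ε ≤ expFrac C q)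
    (hεbound : ε ≤ (⨆ x : Fin n → Bool, fracC C x) + δ
        - ((b : ℝ) / (C.length : ℝ)) * Real.sqrt (((n : ℝ) + 1) * Real.log (1 / p₀) / 2)
        - 1) :
    1 - p₀ ≤ ∑ x : Fin n → Bool, if 1 - δ ≤ fracC C x then wt q x else 0 := by
  have hm' : (0 : ℝ) < C.length := by exact_mod_cast hm
  have hb' : (0 : ℝ) < b := by exact_mod_cast hb
  have hL : 0 < Real.log (1 / p₀) := Real.log_pos (by rw [one_div]; exact (one_lt_inv₀ hp0).2 hp1)
  set L := Real.log (1 / p₀) with hLdef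
  set c : ℝ := (b : ℝ) / C.length with hc
  have hc0 : 0 < c := by positivity
  set r := Real.sqrt (((n : ℝ) + 1) * L / 2) with hr
  have hr2 : r ^ 2 = ((n : ℝ) + 1) * L / 2 := Real.sq_sqrt (by positivity)
  have hr0 : 0 ≤ r := Real.sqrt_nonneg _
  have hdiff : ∀ x i v, |fracC C (Function.update x i v) - fracC C x| ≤ c := fun x i v => by
    rw [fracC, fracC, ← sub_div, abs_div, abs_of_pos hm', hc]
    refine div_le_div_of_nonneg_right ?_ hm'.le
    exact (abs_satC_update_sub_le C x i v).trans (by exact_mod_cast hocc i)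
  set s : ℝ := 4 * r / ((n + 1) * c) with hs
  have hs0 : 0 ≤ s := by positivity
  have htail := sum_wt_lt_le hq (fracC C) hdiff (1 - δ) hs0
  have hexp : s * (1 - δ - expFrac C q) + n * ((s * c) ^ 2 / 8) ≤ -L := by
    have h₁ : s * (1 - δ - expFrac C q) ≤ s * (-(c * r)) :=
      mul_le_mul_of_nonneg_left (by linarith) hs0
    have h₂ : s * (c * r) = 2 * L := by
      have : s * (c * r) = 4 * r ^ 2 / (n + 1) := by rw [hs]; field_simp
      rw [this, hr2]; field_simp; norm_num
    have h₃ : ((n : ℝ) + 1) * ((s * c) ^ 2 / 8) = L := by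
      have : ((n : ℝ) + 1) * ((s * c) ^ 2 / 8) = 2 * r ^ 2 / (n + 1) := by
        rw [hs]; field_simp; ring
      rw [this, hr2]; field_simp
    nlinarith [sq_nonneg (s * c)]
  have hp : Real.exp (-L) = p₀ := by
    rw [hLdef, one_div, Real.log_inv, neg_neg, Real.exp_log hp0]
  have hbad : ∑ x, (if 1 - δ ≤ fracC C x then 0 else wt q x) ≤ p₀ :=
    htail.trans (hp ▸ Real.exp_le_exp.2 hexp)
  have hsplit : (∑ x, if 1 - δ ≤ fracC C x then wt q x else 0) +
      ∑ x, (if 1 - δ ≤ fracC C x then 0 else wt q x) = 1 := by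
    rw [← sum_add_distrib, ← sum_wt q]
    exact sum_congr rfl fun x _ => by split_ifs <;> simp
  linarith
end
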